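/- Let P and Q be Borel probability measures on ℝ^d with finite first moments, and let X, X' ~ P and Y, Y' ~ Q be independent. Define D²(P,Q) = 2E‖X−Y‖ − E‖X−X'‖ − E‖Y−Y'‖. Then D²(P,Q) ≥ 0, with equality if and only if P = Q. -/

import Mathlib

open MeasureTheory

open Real Set
open scoped ComplexConjugate InnerProductSpace

section EnergyDistance

variable {E : Type*} [NormedAddCommGroup E] [InnerProductSpace ℝ E] [FiniteDimensional ℝ E]
  [MeasurableSpace E]

/-- The mean of the Gaussian kernel `exp (-a ‖x - y‖²)` under the product measure `μ × ν`. -/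
noncomputable def gaussKernelMean (a : ℝ) (μ ν : Measure E) : ℝ :=
  ∫ p, rexp (-a * ‖p.1 - p.2‖ ^ 2) ∂(μ.prod ν)

lemma integral_exp_inner_sub_eq_charFun_mul (μ ν : Measure E) [IsProbabilityMeasure μ]
    [IsProbabilityMeasure ν] (t : E) :
    ∫ p : E × E, Complex.exp (Complex.I * ⟪p.1 - p.2, t⟫_ℝ) ∂(μ.prod ν)
      = charFun μ t * conj (charFun ν t) := by
  rw [← charFun_neg, charFun_apply, charFun_apply, ← integral_prod_mul]
  congr 1 with p
  rw [← Complex.exp_add]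
  congr 1
  simp only [inner_sub_left, inner_neg_right]
  push_cast
  ring

lemma gaussKernelMean_comm (a : ℝ) (μ ν : Measure E) [IsProbabilityMeasure μ]
    [IsProbabilityMeasure ν] : gaussKernelMean a μ ν = gaussKernelMean a ν μ := by
  unfold gaussKernelMean
  rw [← integral_prod_swap]
  simp [norm_sub_rev]

variable [BorelSpace E]

lemma integral_gaussian_mul_charFun {b : ℝ} (hb : 0 < b) (μ ν : Measure E)
    [IsProbabilityMeasure μ] [IsProbabilityMeasure ν] :
    ∫ t : E, (rexp (-b * ‖t‖ ^ 2) : ℂ) * (charFun μ t * conj (charFun ν t))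
      = (((∫ t : E, rexp (-b * ‖t‖ ^ 2)) * gaussKernelMean (1 / (4 * b)) μ ν : ℝ) : ℂ) := by
  have hbc : 0 < (b : ℂ).re := by simpa using hb
  have hint : Integrable (fun t : E ↦ (rexp (-b * ‖t‖ ^ 2) : ℂ)) := by
    simpa using GaussianFourier.integrable_cexp_neg_mul_sq_norm_add (V := E) hbc 0 0
  have hswap : Integrable (Function.uncurry fun (t : E) (p : E × E) ↦
      (rexp (-b * ‖t‖ ^ 2) : ℂ) * Complex.exp (Complex.I * ⟪p.1 - p.2, t⟫_ℝ))
      (volume.prod (μ.prod ν)) := by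
    have h1 : Integrable (fun z : E × (E × E) ↦ (rexp (-b * ‖z.1‖ ^ 2) : ℂ))
        (volume.prod (μ.prod ν)) := hint.comp_fst _
    refine (h1.bdd_mul (c := 1) (f := fun z : E × (E × E) ↦
      Complex.exp (Complex.I * ⟪z.2.1 - z.2.2, z.1⟫_ℝ)) ?_ ?_).congr ?_
    · exact Continuous.aestronglyMeasurable (by fun_prop)
    · refine .of_forall fun z ↦ ?_
      rw [mul_comm, Complex.norm_exp_ofReal_mul_I]
    · exact .of_forall fun z ↦ mul_comm _ _
  simp_rw [← integral_exp_inner_sub_eq_charFun_mul μ ν, ← integral_const_mul]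
  rw [integral_integral_swap hswap, gaussKernelMean, ← integral_const_mul, ← integral_complex_ofReal]
  congr 1 with p
  have h := GaussianFourier.integral_cexp_neg_mul_sq_norm_add (V := E) hbc Complex.I (p.1 - p.2)
  have h0 := GaussianFourier.integral_cexp_neg_mul_sq_norm (V := E) hbc
  rw [← h0] at h
  push_cast
  rw [← integral_complex_ofReal]
  push_cast
  simp_rw [← Complex.exp_add]
  rw [h]
  congr 2
  rw [Complex.I_sq]
  field_simp

lemma integral_gaussian_mul_normSq_charFun_sub {b : ℝ} (hb : 0 < b) (μ ν : Measure E)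
    [IsProbabilityMeasure μ] [IsProbabilityMeasure ν] :
    Integrable (fun t : E ↦ rexp (-b * ‖t‖ ^ 2) * ‖charFun μ t - charFun ν t‖ ^ 2) ∧
    ∫ t : E, rexp (-b * ‖t‖ ^ 2) * ‖charFun μ t - charFun ν t‖ ^ 2
      = (∫ t : E, rexp (-b * ‖t‖ ^ 2)) * (gaussKernelMean (1 / (4 * b)) μ μ
        + gaussKernelMean (1 / (4 * b)) ν ν - gaussKernelMean (1 / (4 * b)) μ ν
        - gaussKernelMean (1 / (4 * b)) ν μ) := by
  have hbc : 0 < (b : ℂ).re := by simpa using hb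
  have hint : Integrable (fun t : E ↦ (rexp (-b * ‖t‖ ^ 2) : ℂ)) := by
    simpa using GaussianFourier.integrable_cexp_neg_mul_sq_norm_add (V := E) hbc 0 0
  have hI (μ ν : Measure E) [IsProbabilityMeasure μ] [IsProbabilityMeasure ν] :
      Integrable (fun t : E ↦ (rexp (-b * ‖t‖ ^ 2) : ℂ) * (charFun μ t * conj (charFun ν t))) := by
    refine (hint.bdd_mul (c := 1) (f := fun t ↦ charFun μ t * conj (charFun ν t)) ?_ ?_).congr ?_
    · exact (continuous_charFun.mul
        (Complex.continuous_conj.comp continuous_charFun)).aestronglyMeasurable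
    · refine .of_forall fun t ↦ ?_
      rw [norm_mul, RCLike.norm_conj]
      exact mul_le_one₀ (norm_charFun_le_one t) (norm_nonneg _) (norm_charFun_le_one t)
    · exact .of_forall fun z ↦ mul_comm _ _
  have heq (t : E) : ((rexp (-b * ‖t‖ ^ 2) * ‖charFun μ t - charFun ν t‖ ^ 2 : ℝ) : ℂ)
      = (rexp (-b * ‖t‖ ^ 2) : ℂ) * (charFun μ t * conj (charFun μ t))
        + (rexp (-b * ‖t‖ ^ 2) : ℂ) * (charFun ν t * conj (charFun ν t))
        - (rexp (-b * ‖t‖ ^ 2) : ℂ) * (charFun μ t * conj (charFun ν t))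
        - (rexp (-b * ‖t‖ ^ 2) : ℂ) * (charFun ν t * conj (charFun μ t)) := by
    rw [Complex.ofReal_mul, Complex.ofReal_pow, ← Complex.mul_conj', map_sub]
    ring
  have hIc := (((hI μ μ).add (hI ν ν)).sub (hI μ ν)).sub (hI ν μ)
  constructor
  · refine hIc.re.congr (.of_forall fun t ↦ ?_)
    simp only [Pi.add_apply, Pi.sub_apply]
    rw [← heq]
    simp only [RCLike.re_to_complex, Complex.ofReal_re]
  · apply Complex.ofReal_injective
    rw [← integral_complex_ofReal]
    simp_rw [heq]
    rw [integral_sub, integral_sub, integral_add (hI μ μ) (hI ν ν)]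
    · simp_rw [integral_gaussian_mul_charFun hb]
      push_cast
      ring
    · exact (hI μ μ).add (hI ν ν)
    · exact hI μ ν
    · exact ((hI μ μ).add (hI ν ν)).sub (hI μ ν)
    · exact hI ν μ

lemma integral_exp_neg_mul_sq_norm_pos {b : ℝ} (hb : 0 < b) :
    0 < ∫ t : E, rexp (-b * ‖t‖ ^ 2) := by
  rw [GaussianFourier.integral_rexp_neg_mul_sq_norm hb]
  positivity

/-- The squared maximum mean discrepancy of the Gaussian kernel is nonnegative. -/
lemma gaussKernelMean_discrepancy_nonneg {a : ℝ} (ha : 0 < a) (μ ν : Measure E)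
    [IsProbabilityMeasure μ] [IsProbabilityMeasure ν] :
    0 ≤ gaussKernelMean a μ μ + gaussKernelMean a ν ν - 2 * gaussKernelMean a μ ν := by
  have hb : 0 < 1 / (4 * a) := by positivity
  have h := (integral_gaussian_mul_normSq_charFun_sub hb μ ν).2
  rw [show 1 / (4 * (1 / (4 * a))) = a by field_simp, gaussKernelMean_comm a ν μ] at h
  refine nonneg_of_mul_nonneg_right ?_ (integral_exp_neg_mul_sq_norm_pos (E := E) hb)
  calc 0 ≤ ∫ t : E, rexp (-(1 / (4 * a)) * ‖t‖ ^ 2) * ‖charFun μ t - charFun ν t‖ ^ 2 :=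
        integral_nonneg fun t ↦ by positivity
    _ = _ := by rw [h]; ring

/-- The Gaussian kernel is characteristic. -/
lemma eq_of_gaussKernelMean_discrepancy_eq_zero {a : ℝ} (ha : 0 < a) {μ ν : Measure E}
    [IsProbabilityMeasure μ] [IsProbabilityMeasure ν]
    (h0 : gaussKernelMean a μ μ + gaussKernelMean a ν ν - 2 * gaussKernelMean a μ ν = 0) :
    μ = ν := by
  have hb : 0 < 1 / (4 * a) := by positivity
  obtain ⟨hi, h⟩ := integral_gaussian_mul_normSq_charFun_sub hb μ ν
  rw [show 1 / (4 * (1 / (4 * a))) = a by field_simp, gaussKernelMean_comm a ν μ,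
    sub_sub, ← two_mul, h0, mul_zero,
    integral_eq_zero_iff_of_nonneg (fun t ↦ by positivity) hi] at h
  have hcont : Continuous fun t : E ↦
      rexp (-(1 / (4 * a)) * ‖t‖ ^ 2) * ‖charFun μ t - charFun ν t‖ ^ 2 := by
    have hμ : Continuous (charFun μ) := continuous_charFun
    have hν : Continuous (charFun ν) := continuous_charFun
    fun_prop
  have heq := (Continuous.ae_eq_iff_eq volume hcont continuous_zero).1 h
  refine Measure.ext_of_charFun (funext fun t ↦ ?_)
  have ht := congrFun heq t
  simpa [sub_eq_zero] using ht

lemma integrableOn_one_sub_exp_neg_sq_div_sq :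
    IntegrableOn (fun s : ℝ ↦ (1 - rexp (-s ^ 2)) / s ^ 2) (Ioi 0) := by
  have hm : Measurable fun s : ℝ ↦ (1 - rexp (-s ^ 2)) / s ^ 2 := by fun_prop
  have hnn (s : ℝ) : 0 ≤ 1 - rexp (-s ^ 2) := by
    rw [sub_nonneg, Real.exp_le_one_iff]
    exact neg_nonpos.2 (sq_nonneg s)
  rw [← Ioc_union_Ioi_eq_Ioi zero_le_one]
  refine IntegrableOn.union ?_ ?_
  · refine Integrable.mono' (integrable_const (1 : ℝ)) hm.aestronglyMeasurable
      (.of_forall fun s ↦ ?_)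
    rw [Real.norm_of_nonneg (div_nonneg (hnn s) (sq_nonneg s))]
    refine div_le_one_of_le₀ ?_ (sq_nonneg s)
    linarith [Real.add_one_le_exp (-s ^ 2)]
  · refine Integrable.mono' (integrableOn_Ioi_rpow_of_lt (a := -2) (by norm_num) one_pos)
      hm.aestronglyMeasurable ?_
    refine (ae_restrict_mem measurableSet_Ioi).mono fun s hs ↦ ?_
    have hs0 : (0 : ℝ) < s := one_pos.trans hs
    rw [Real.norm_of_nonneg (div_nonneg (hnn s) (sq_nonneg s)), Real.rpow_neg hs0.le,
      Real.rpow_two, ← one_div]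
    gcongr
    linarith [Real.exp_pos (-s ^ 2)]

lemma integral_one_sub_exp_neg_sq_div_sq_pos :
    0 < ∫ s in Ioi (0 : ℝ), (1 - rexp (-s ^ 2)) / s ^ 2 := by
  have hpos (s : ℝ) (hs : 0 < s) : 0 < (1 - rexp (-s ^ 2)) / s ^ 2 := by
    have : rexp (-s ^ 2) < 1 := by
      rw [Real.exp_lt_one_iff]
      exact neg_neg_of_pos (by positivity)
    exact div_pos (by linarith) (by positivity)
  rw [setIntegral_pos_iff_support_of_nonneg_ae
    ((ae_restrict_mem measurableSet_Ioi).mono fun s hs ↦ (hpos s hs).le)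
    integrableOn_one_sub_exp_neg_sq_div_sq]
  have hsub : Ioi (0 : ℝ) ⊆ Function.support fun s : ℝ ↦ (1 - rexp (-s ^ 2)) / s ^ 2 :=
    fun s hs ↦ (hpos s hs).ne'
  rw [inter_eq_right.2 hsub]
  simp

lemma one_sub_exp_div_sq_eq_sq_mul {r : ℝ} (hr : 0 < r) (s : ℝ) :
    (1 - rexp (-s ^ 2 * r ^ 2)) / s ^ 2 = r ^ 2 * ((1 - rexp (-(r * s) ^ 2)) / (r * s) ^ 2) := by
  rw [show -s ^ 2 * r ^ 2 = -(r * s) ^ 2 by ring, mul_pow]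
  field_simp

lemma integrableOn_one_sub_exp_neg_sq_mul_div_sq {r : ℝ} (hr : 0 ≤ r) :
    IntegrableOn (fun s : ℝ ↦ (1 - rexp (-s ^ 2 * r ^ 2)) / s ^ 2) (Ioi 0) := by
  rcases hr.eq_or_lt with rfl | hr
  · simp
  simp_rw [one_sub_exp_div_sq_eq_sq_mul hr]
  refine Integrable.const_mul ?_ _
  have := (integrableOn_Ioi_comp_mul_left_iff
    (fun s : ℝ ↦ (1 - rexp (-s ^ 2)) / s ^ 2) 0 hr).2
  rw [mul_zero] at this
  exact this integrableOn_one_sub_exp_neg_sq_div_sq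

lemma integral_one_sub_exp_neg_sq_mul_div_sq {r : ℝ} (hr : 0 ≤ r) :
    ∫ s in Ioi (0 : ℝ), (1 - rexp (-s ^ 2 * r ^ 2)) / s ^ 2
      = (∫ s in Ioi (0 : ℝ), (1 - rexp (-s ^ 2)) / s ^ 2) * r := by
  rcases hr.eq_or_lt with rfl | hr
  · simp
  simp_rw [one_sub_exp_div_sq_eq_sq_mul hr]
  rw [integral_const_mul,
    integral_comp_mul_left_Ioi (fun s : ℝ ↦ (1 - rexp (-s ^ 2)) / s ^ 2) 0 hr, mul_zero,
    smul_eq_mul]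
  field_simp

lemma integrable_norm_sub_prod {μ ν : Measure E} [IsProbabilityMeasure μ]
    [IsProbabilityMeasure ν] (hμ : Integrable (fun x ↦ ‖x‖) μ) (hν : Integrable (fun x ↦ ‖x‖) ν) :
    Integrable (fun p : E × E ↦ ‖p.1 - p.2‖) (μ.prod ν) := by
  refine ((hμ.comp_fst ν).add (hν.comp_snd μ)).mono'
    (Continuous.aestronglyMeasurable (by fun_prop)) (.of_forall fun p ↦ ?_)
  rw [norm_norm]
  exact norm_sub_le _ _

lemma integrable_exp_neg_mul_sq_norm_sub {a : ℝ} (ha : 0 ≤ a) (μ ν : Measure E)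
    [IsProbabilityMeasure μ] [IsProbabilityMeasure ν] :
    Integrable (fun p : E × E ↦ rexp (-a * ‖p.1 - p.2‖ ^ 2)) (μ.prod ν) := by
  refine (integrable_const (1 : ℝ)).mono' (Continuous.aestronglyMeasurable (by fun_prop))
    (.of_forall fun p ↦ ?_)
  rw [Real.norm_of_nonneg (Real.exp_pos _).le, Real.exp_le_one_iff, neg_mul]
  exact neg_nonpos.2 (by positivity)

/-- The mean distance is a mixture of Gaussian kernel means. -/
lemma integral_norm_sub_eq_integral_gaussKernelMean {μ ν : Measure E} [IsProbabilityMeasure μ]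
    [IsProbabilityMeasure ν] (hμ : Integrable (fun x ↦ ‖x‖) μ) (hν : Integrable (fun x ↦ ‖x‖) ν) :
    IntegrableOn (fun s : ℝ ↦ (1 - gaussKernelMean (s ^ 2) μ ν) / s ^ 2) (Ioi 0) ∧
    (∫ s in Ioi (0 : ℝ), (1 - rexp (-s ^ 2)) / s ^ 2) * ∫ p, ‖p.1 - p.2‖ ∂(μ.prod ν)
      = ∫ s in Ioi (0 : ℝ), (1 - gaussKernelMean (s ^ 2) μ ν) / s ^ 2 := by
  have hinner (s : ℝ) : ∫ p : E × E, (1 - rexp (-s ^ 2 * ‖p.1 - p.2‖ ^ 2)) / s ^ 2 ∂(μ.prod ν)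
      = (1 - gaussKernelMean (s ^ 2) μ ν) / s ^ 2 := by
    rw [integral_div, integral_sub (integrable_const _)
      (integrable_exp_neg_mul_sq_norm_sub (sq_nonneg s) μ ν)]
    simp [gaussKernelMean]
  have hI : Integrable (fun z : (E × E) × ℝ ↦
      (1 - rexp (-z.2 ^ 2 * ‖z.1.1 - z.1.2‖ ^ 2)) / z.2 ^ 2)
      ((μ.prod ν).prod (volume.restrict (Ioi 0))) := by
    have hnum : Continuous fun z : (E × E) × ℝ ↦ 1 - rexp (-z.2 ^ 2 * ‖z.1.1 - z.1.2‖ ^ 2) := by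
      fun_prop
    have hden : Measurable fun z : (E × E) × ℝ ↦ z.2 ^ 2 := measurable_snd.pow_const 2
    have hmeas : AEStronglyMeasurable (fun z : (E × E) × ℝ ↦
        (1 - rexp (-z.2 ^ 2 * ‖z.1.1 - z.1.2‖ ^ 2)) / z.2 ^ 2)
        ((μ.prod ν).prod (volume.restrict (Ioi 0))) :=
      (hnum.measurable.div hden).aestronglyMeasurable
    rw [integrable_prod_iff hmeas]
    constructor
    · refine .of_forall fun p ↦ ?_
      have hp := integrableOn_one_sub_exp_neg_sq_mul_div_sq (norm_nonneg (p.1 - p.2))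
      rw [IntegrableOn] at hp
      simpa only using hp
    · refine ((integrable_norm_sub_prod hμ hν).const_mul
        (∫ s in Ioi (0 : ℝ), (1 - rexp (-s ^ 2)) / s ^ 2)).congr (.of_forall fun p ↦ ?_)
      simp only
      rw [← integral_one_sub_exp_neg_sq_mul_div_sq (norm_nonneg (p.1 - p.2))]
      congr 1 with s
      rw [Real.norm_of_nonneg]
      refine div_nonneg ?_ (sq_nonneg s)
      rw [sub_nonneg, Real.exp_le_one_iff, neg_mul]
      exact neg_nonpos.2 (by positivity)
  constructor
  · refine hI.integral_prod_right.congr (.of_forall fun s ↦ hinner s)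
  · simp_rw [← hinner]
    rw [← integral_integral_swap (f := fun (p : E × E) (s : ℝ) ↦
      (1 - rexp (-s ^ 2 * ‖p.1 - p.2‖ ^ 2)) / s ^ 2) hI, ← integral_const_mul]
    simp_rw [integral_one_sub_exp_neg_sq_mul_div_sq (norm_nonneg _)]

/-- The energy distance is a mixture of Gaussian kernel discrepancies. -/
lemma energyDistance_eq_integral_gaussKernelMean {μ ν : Measure E} [IsProbabilityMeasure μ]
    [IsProbabilityMeasure ν] (hμ : Integrable (fun x ↦ ‖x‖) μ) (hν : Integrable (fun x ↦ ‖x‖) ν) :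
    IntegrableOn (fun s : ℝ ↦ (gaussKernelMean (s ^ 2) μ μ + gaussKernelMean (s ^ 2) ν ν
      - 2 * gaussKernelMean (s ^ 2) μ ν) / s ^ 2) (Ioi 0) ∧
    (∫ s in Ioi (0 : ℝ), (1 - rexp (-s ^ 2)) / s ^ 2) *
        (2 * (∫ p, ‖p.1 - p.2‖ ∂(μ.prod ν)) - (∫ p, ‖p.1 - p.2‖ ∂(μ.prod μ))
        - (∫ p, ‖p.1 - p.2‖ ∂(ν.prod ν)))
      = ∫ s in Ioi (0 : ℝ), (gaussKernelMean (s ^ 2) μ μ + gaussKernelMean (s ^ 2) ν ν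
        - 2 * gaussKernelMean (s ^ 2) μ ν) / s ^ 2 := by
  obtain ⟨i1, e1⟩ := integral_norm_sub_eq_integral_gaussKernelMean hμ hν
  obtain ⟨i2, e2⟩ := integral_norm_sub_eq_integral_gaussKernelMean hμ hμ
  obtain ⟨i3, e3⟩ := integral_norm_sub_eq_integral_gaussKernelMean hν hν
  have heq (s : ℝ) : (gaussKernelMean (s ^ 2) μ μ + gaussKernelMean (s ^ 2) ν ν
      - 2 * gaussKernelMean (s ^ 2) μ ν) / s ^ 2
      = 2 * ((1 - gaussKernelMean (s ^ 2) μ ν) / s ^ 2) - (1 - gaussKernelMean (s ^ 2) μ μ) / s ^ 2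
        - (1 - gaussKernelMean (s ^ 2) ν ν) / s ^ 2 := by ring
  simp_rw [heq]
  refine ⟨((i1.const_mul 2).sub i2).sub i3, ?_⟩
  rw [integral_sub, integral_sub (i1.const_mul 2) i2, integral_const_mul, ← e1, ← e2, ← e3]
  · ring
  · exact (i1.const_mul 2).sub i2
  · exact i3

end EnergyDistance

/-- The squared energy distance
`D²(P,Q) = 2E‖X−Y‖ − E‖X−X'‖ − E‖Y−Y'‖` between Borel probability measures `P, Q` on
`ℝ^d` with finite first moments is nonnegative, and vanishes iff `P = Q`. -/
theorem stmt18 {d : ℕ} (P Q : Measure (EuclideanSpace ℝ (Fin d)))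
    [IsProbabilityMeasure P] [IsProbabilityMeasure Q]
    (hP : Integrable (fun x => ‖x‖) P) (hQ : Integrable (fun x => ‖x‖) Q) :
    0 ≤ 2 * (∫ p, ‖p.1 - p.2‖ ∂(P.prod Q)) - (∫ p, ‖p.1 - p.2‖ ∂(P.prod P))
        - (∫ p, ‖p.1 - p.2‖ ∂(Q.prod Q)) ∧
    (2 * (∫ p, ‖p.1 - p.2‖ ∂(P.prod Q)) - (∫ p, ‖p.1 - p.2‖ ∂(P.prod P))
        - (∫ p, ‖p.1 - p.2‖ ∂(Q.prod Q)) = 0 ↔ P = Q) := by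
  obtain ⟨hi, h⟩ := energyDistance_eq_integral_gaussKernelMean hP hQ
  have hC := integral_one_sub_exp_neg_sq_div_sq_pos
  have hnn : 0 ≤ᵐ[volume.restrict (Ioi (0 : ℝ))] fun s : ℝ ↦
      (gaussKernelMean (s ^ 2) P P + gaussKernelMean (s ^ 2) Q Q
        - 2 * gaussKernelMean (s ^ 2) P Q) / s ^ 2 :=
    (ae_restrict_mem measurableSet_Ioi).mono fun s hs ↦
      div_nonneg (gaussKernelMean_discrepancy_nonneg (pow_pos hs 2) P Q) (sq_nonneg s)
  refine ⟨nonneg_of_mul_nonneg_right (h ▸ integral_nonneg_of_ae hnn) hC, fun h0 ↦ ?_, ?_⟩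
  · rw [h0, mul_zero, eq_comm, integral_eq_zero_iff_of_nonneg_ae hnn hi] at h
    have : (ae (volume.restrict (Ioi (0 : ℝ)))).NeBot := by
      rw [ae_neBot, Ne, Measure.restrict_eq_zero]
      simp
    obtain ⟨s, hs, hs0⟩ := (h.and (ae_restrict_mem measurableSet_Ioi)).exists
    have hs2 : 0 < s ^ 2 := pow_pos hs0 2
    exact eq_of_gaussKernelMean_discrepancy_eq_zero hs2
      ((div_eq_zero_iff.1 hs).resolve_right hs2.ne')
  · rintro rfl
    ring
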